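/- arXiv:1807.05892 — 2 statements merged into one kernel-verified Lean document; each statement's English description precedes it below -/
import Mathlib

section
/- Every torsion element of Γ acts freely on XΓ: if a ∈ Γ has finite order and a·x = x for some x ∈ XΓ (diagonal action), then a = e. In other words, XΓ has property (TAF). -/
/-- The action of `γ ∈ Γ` on sections of `π : Γ → Γ ⧸ F`: `(γ · s)(q) = γ * s (γ⁻¹ • q)`. -/
def sectAct {Γ : Type*} [Group Γ] {F : Subgroup Γ} (γ : Γ) (s : (Γ ⧸ F) → Γ) :
    (Γ ⧸ F) → Γ :=
  fun q => γ * s (γ⁻¹ • q)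

/-- Every torsion element of `Γ` acts freely on `XΓ = ∏_{F ∈ 𝓕} X_F` (the product over
all finite subgroups `F` of `Γ` of the spaces of sections of `Γ → Γ ⧸ F`, with the
diagonal action): if `a ∈ Γ` has finite order and fixes some point `x ∈ XΓ`, then `a = 1`.
In other words, `XΓ` has property (TAF). -/
theorem XGamma_TAF {Γ : Type*} [Group Γ] (a : Γ) (ha : IsOfFinOrder a)
    (x : ∀ F : {F : Subgroup Γ // (F : Set Γ).Finite},
      {s : (Γ ⧸ F.1) → Γ // ∀ q, QuotientGroup.mk (s q) = q})
    (hfix : ∀ F, sectAct a (x F).1 = (x F).1) :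
    a = 1 := by
  have hF : (Subgroup.zpowers a : Set Γ).Finite := finite_zpowers.mpr ha
  have hq : a⁻¹ • ((1 : Γ) : Γ ⧸ Subgroup.zpowers a) = ((1 : Γ) : Γ ⧸ Subgroup.zpowers a) := by
    rw [MulAction.Quotient.smul_coe, QuotientGroup.eq]
    simp
  have h := congrFun (hfix ⟨Subgroup.zpowers a, hF⟩) ((1 : Γ) : Γ ⧸ Subgroup.zpowers a)
  simp only [sectAct, hq] at h
  exact mul_eq_right.mp h
end

section
/- XΓ is a compact Hausdorff space (for the product topology, each X_F carrying the subspace topology of the product topology on Γ/F → Γ with Γ discrete), the product measure m = ∏_{F ∈ 𝓕} m^F is a Γ-invariant probability measure on XΓ, and every element of Γ of finite order acts freely on XΓ. -/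
set_option maxHeartbeats 1000000

open MeasureTheory

/-- The uniform probability measure on the fiber `π_F⁻¹(q)` of the quotient map
`π_F : Γ → Γ ⧸ F`: each point of the fiber has mass `(#F)⁻¹`. -/
noncomputable def uniformFiber {Γ : Type*} [Group Γ] [MeasurableSpace Γ]
    (F : Subgroup Γ) (q : Γ ⧸ F) :
    Measure {g : Γ // QuotientGroup.mk g = q} :=
  (Nat.card F : ENNReal)⁻¹ • Measure.count

/-- The action of `γ ∈ Γ` on the set `X_F` of sections of `π_F : Γ → Γ ⧸ F`,
identified with the product of the fibers of `π_F`: `(γ · s)(q) = γ * s (γ⁻¹ • q)`. -/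
def fibAct {Γ : Type*} [Group Γ] (F : Subgroup Γ) (γ : Γ)
    (s : ∀ q : Γ ⧸ F, {g : Γ // QuotientGroup.mk g = q}) :
    ∀ q : Γ ⧸ F, {g : Γ // QuotientGroup.mk g = q} :=
  fun q => ⟨γ * (s (γ⁻¹ • q) : Γ), by
    have h : (QuotientGroup.mk (γ * (s (γ⁻¹ • q) : Γ)) : Γ ⧸ F)
        = γ • (QuotientGroup.mk ((s (γ⁻¹ • q) : Γ)) : Γ ⧸ F) := rfl
    rw [h, (s (γ⁻¹ • q)).2, smul_inv_smul]⟩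

/-- `XΓ = ∏_{F ∈ 𝓕} X_F`, the product over the set `𝓕` of all finite subgroups `F ⊆ Γ`
of the spaces `X_F` of sections of `π_F : Γ → Γ ⧸ F`, where `X_F` is identified with the
product `∏_{q ∈ Γ/F} π_F⁻¹(q)` of the fibers of `π_F`. -/
abbrev XGamma (Γ : Type*) [Group Γ] : Type _ :=
  ∀ F : {F : Subgroup Γ // (F : Set Γ).Finite},
    ∀ q : Γ ⧸ F.1, {g : Γ // QuotientGroup.mk g = q}

/-- Left multiplication by `γ` as an equivalence between the fibers of `π_F` over `γ⁻¹ • q`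
and over `q`. -/
def fiberMulLeft {Γ : Type*} [Group Γ] (F : Subgroup Γ) (γ : Γ) (q : Γ ⧸ F) :
    {g : Γ // QuotientGroup.mk g = γ⁻¹ • q} ≃ {g : Γ // QuotientGroup.mk g = q} :=
  (Equiv.mulLeft γ).subtypeEquiv fun g => by
    rw [eq_inv_smul_iff]
    rfl

/-- Left multiplication identifies each fiber of `π_F` with `F`. -/
def fiberEquivSubgroup {Γ : Type*} [Group Γ] (F : Subgroup Γ) (g₀ : Γ) :
    {g : Γ // (QuotientGroup.mk g : Γ ⧸ F) = QuotientGroup.mk g₀} ≃ F :=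
  (Equiv.mulLeft g₀⁻¹).subtypeEquiv fun g => by
    rw [eq_comm, QuotientGroup.eq]
    rfl

theorem finite_fiber {Γ : Type*} [Group Γ] (F : Subgroup Γ) [Finite F] (q : Γ ⧸ F) :
    Finite {g : Γ // QuotientGroup.mk g = q} := by
  obtain ⟨g₀, rfl⟩ := QuotientGroup.mk_surjective q
  exact Finite.of_equiv F (fiberEquivSubgroup F g₀).symm

theorem card_fiber {Γ : Type*} [Group Γ] (F : Subgroup Γ) (q : Γ ⧸ F) :
    Nat.card {g : Γ // QuotientGroup.mk g = q} = Nat.card F := by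
  obtain ⟨g₀, rfl⟩ := QuotientGroup.mk_surjective q
  exact Nat.card_congr (fiberEquivSubgroup F g₀)

instance Subtype.instDiscreteMeasurableSpace {α : Type*} [MeasurableSpace α]
    [DiscreteMeasurableSpace α] {p : α → Prop} : DiscreteMeasurableSpace (Subtype p) where
  forall_measurableSet s := 
    ⟨Set.image (↑) s, .of_discrete, Set.preimage_image_eq s Subtype.val_injective⟩

theorem isProbabilityMeasure_uniformFiber {Γ : Type*} [Group Γ] [MeasurableSpace Γ]
    [DiscreteMeasurableSpace Γ] (F : Subgroup Γ) [Finite F] (q : Γ ⧸ F) :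
    IsProbabilityMeasure (uniformFiber F q) := by
  have := finite_fiber F q
  constructor
  rw [uniformFiber, Measure.smul_apply, Measure.count_univ, ENat.card_eq_coe_natCard, card_fiber,
    smul_eq_mul]
  exact ENNReal.inv_mul_cancel (by simpa using Nat.card_pos.ne.symm) (by simp)

theorem map_fiberMulLeft_uniformFiber {Γ : Type*} [Group Γ] [MeasurableSpace Γ]
    [DiscreteMeasurableSpace Γ] (F : Subgroup Γ) (γ : Γ) (q : Γ ⧸ F) :
    (uniformFiber F (γ⁻¹ • q)).map (fiberMulLeft F γ q) = uniformFiber F q := by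
  ext s hs
  rw [Measure.map_apply .of_discrete hs, uniformFiber, uniformFiber, Measure.smul_apply,
    Measure.smul_apply, Measure.count_apply .of_discrete, Measure.count_apply hs,
    Set.encard_preimage_of_bijective (fiberMulLeft F γ q).bijective]

/-- Reindexing the coordinates of a product probability measure. -/
theorem infinitePi_map_comp_equiv {ι κ : Type*} {X : ι → Type*} [∀ i, MeasurableSpace (X i)]
    (μ : ∀ i, Measure (X i)) [∀ i, IsProbabilityMeasure (μ i)] (e : κ ≃ ι) :
    (Measure.infinitePi μ).map (fun x k => x (e k)) = Measure.infinitePi fun k => μ (e k) :=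
  (MeasurableEquiv.map_apply_eq_iff_map_symm_apply_eq
    (MeasurableEquiv.piCongrLeft X e)).1 (Measure.infinitePi_map_piCongrLeft μ e) |>.symm

theorem measurePreserving_fibAct {Γ : Type*} [Group Γ] [MeasurableSpace Γ]
    [DiscreteMeasurableSpace Γ] (F : Subgroup Γ) [Finite F] (γ : Γ) :
    MeasurePreserving (fibAct F γ) (Measure.infinitePi (uniformFiber F))
      (Measure.infinitePi (uniformFiber F)) := by
  have hprob := isProbabilityMeasure_uniformFiber F
  have hmul (q) : Measurable (fiberMulLeft F γ q) := .of_discrete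
  have hreindex : MeasurePreserving
      (fun (s : ∀ q : Γ ⧸ F, {g : Γ // QuotientGroup.mk g = q}) (q : Γ ⧸ F) => s (γ⁻¹ • q))
      (Measure.infinitePi (uniformFiber F))
      (Measure.infinitePi fun q => uniformFiber F (γ⁻¹ • q)) :=
    ⟨by fun_prop, infinitePi_map_comp_equiv (uniformFiber F) (MulAction.toPerm γ⁻¹)⟩
  have hfiber : MeasurePreserving
      (fun (s : ∀ q : Γ ⧸ F, {g : Γ // QuotientGroup.mk g = γ⁻¹ • q}) (q : Γ ⧸ F) =>
        fiberMulLeft F γ q (s q))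
      (Measure.infinitePi fun q => uniformFiber F (γ⁻¹ • q))
      (Measure.infinitePi (uniformFiber F)) := by
    refine ⟨by fun_prop, ?_⟩
    rw [Measure.infinitePi_map_pi _ hmul]
    simp_rw [map_fiberMulLeft_uniformFiber]
  exact hfiber.comp hreindex

theorem eq_one_of_fibAct_eq {Γ : Type*} [Group Γ] {F : Subgroup Γ} {a : Γ} (ha : a ∈ F)
    {s : ∀ q : Γ ⧸ F, {g : Γ // QuotientGroup.mk g = q}} (hs : fibAct F a s = s) : a = 1 := by
  have hq : a⁻¹ • (QuotientGroup.mk 1 : Γ ⧸ F) = QuotientGroup.mk 1 := by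
    rw [inv_smul_eq_iff]
    exact QuotientGroup.eq.2 (by simpa using ha)
  have h : a * (s (a⁻¹ • (QuotientGroup.mk 1 : Γ ⧸ F)) : Γ) = s (QuotientGroup.mk 1) :=
    congrArg Subtype.val (congrFun hs (QuotientGroup.mk 1))
  rw [hq] at h
  exact mul_eq_right.1 h

/-- `XΓ` is a compact Hausdorff space (for the product topology, `Γ` being discrete),
the product measure `m = ∏_{F ∈ 𝓕} m^F` of the product measures `m^F` of the uniform
measures on the fibers (each characterized as a projective limit of finite products)
is a `Γ`-invariant probability measure on `XΓ`, and every element of `Γ` of finite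
order acts freely on `XΓ`. -/
theorem XGamma_compact_T2_invariant_prob_TAF {Γ : Type*} [Group Γ]
    [TopologicalSpace Γ] [DiscreteTopology Γ]
    [MeasurableSpace Γ] [DiscreteMeasurableSpace Γ]
    (mF : ∀ F : {F : Subgroup Γ // (F : Set Γ).Finite},
      Measure (∀ q : Γ ⧸ F.1, {g : Γ // QuotientGroup.mk g = q}))
    (hmF : ∀ F, IsProjectiveLimit (mF F)
      (fun J : Finset (Γ ⧸ F.1) => Measure.pi (fun q : J => uniformFiber F.1 q)))
    (m : Measure (XGamma Γ))
    (hm : IsProjectiveLimit m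
      (fun J : Finset {F : Subgroup Γ // (F : Set Γ).Finite} =>
        Measure.pi (fun F : J => mF F.1))) :
    CompactSpace (XGamma Γ) ∧ T2Space (XGamma Γ) ∧
    IsProbabilityMeasure m ∧
    (∀ γ : Γ, MeasurePreserving
      (fun x : XGamma Γ => fun F => fibAct F.1 γ (x F)) m m) ∧
    (∀ a : Γ, IsOfFinOrder a →
      ∀ x : XGamma Γ, (fun F => fibAct F.1 a (x F)) = x → a = 1) := by
  have hfin (F : {F : Subgroup Γ // (F : Set Γ).Finite}) : Finite F.1 := F.2.to_subtype
  have hfib (F : {F : Subgroup Γ // (F : Set Γ).Finite}) := finite_fiber F.1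
  have hprobF (F : {F : Subgroup Γ // (F : Set Γ).Finite}) :=
    isProbabilityMeasure_uniformFiber F.1
  have hmF_eq (F) : mF F = Measure.infinitePi (uniformFiber F.1) :=
    (hmF F).unique (Measure.isProjectiveLimit_infinitePi _)
  have hprob (F) : IsProbabilityMeasure (mF F) := (hmF F).isProbabilityMeasure
  have hm_eq : m = Measure.infinitePi mF := hm.unique (Measure.isProjectiveLimit_infinitePi _)
  have hact (F) (γ : Γ) : MeasurePreserving (fibAct F.1 γ) (mF F) (mF F) := by
    rw [hmF_eq F]
    exact measurePreserving_fibAct F.1 γ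
  refine ⟨inferInstance, inferInstance, hm.isProbabilityMeasure, fun γ => ?_, ?_⟩
  · have hmeas (F : {F : Subgroup Γ // (F : Set Γ).Finite}) :
        Measurable (fibAct F.1 γ) := (hact F γ).measurable
    refine ⟨by fun_prop, ?_⟩
    rw [hm_eq, Measure.infinitePi_map_pi mF hmeas]
    simp_rw [(hact _ γ).map_eq]
  · intro a ha x hx
    exact eq_one_of_fibAct_eq (Subgroup.mem_zpowers a)
      (congrFun hx ⟨Subgroup.zpowers a, finite_zpowers.2 ha⟩)
end
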